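/- arXiv:1111.1448 — 3 statements merged into one kernel-verified Lean document; each statement's English description precedes it below -/
import Mathlib

section
/- Let X̊ : [0,π] → (0,∞) with log X̊ continuously differentiable on [0,π], and let Y : [0,π] → ℝ be continuously differentiable. Then lim_{ε→0⁺} ( ∫_ε^{π−ε} [ 4 − 4·cot θ·(log X̊)'(θ) − ((log X̊)'(θ))² − Y'(θ)²/(sin⁴θ·X̊(θ)²) ] · sin θ dθ + I_ε[log X̊, Y] ) = 8 + 4·log( X̊(0)·X̊(π) ). -/
open Real Filter Set

/-- The Hennig–Ansorg–Cederbaum horizon integral plus the truncated functional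
`I_ε[log X̊, Y]` converges, as `ε → 0⁺`, to `8 + 4 log(X̊(0)·X̊(π))`.  Here
`(log X̊)' = X̊'/X̊` and
`I_ε[log X̊, Y] = ∫_ε^{π−ε} [X̊'²/X̊² + 4 log X̊ + Y'²/(sin⁴θ X̊²)] sin θ dθ`. -/
theorem horizon_integral_plus_functional_tendsto (X X' Y Y' : ℝ → ℝ)
    (hXpos : ∀ θ ∈ Icc (0:ℝ) π, 0 < X θ)
    (hX : ∀ θ ∈ Icc (0:ℝ) π, HasDerivWithinAt X (X' θ) (Icc 0 π) θ)
    (hX'cont : ContinuousOn X' (Icc 0 π))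
    (hY : ∀ θ ∈ Icc (0:ℝ) π, HasDerivWithinAt Y (Y' θ) (Icc 0 π) θ)
    (hY'cont : ContinuousOn Y' (Icc 0 π)) :
    Tendsto (fun ε : ℝ =>
        (∫ θ in ε..(π - ε),
          (4 - 4 * (Real.cos θ / Real.sin θ) * (X' θ / X θ) - (X' θ / X θ) ^ 2
            - (Y' θ) ^ 2 / (Real.sin θ ^ 4 * (X θ) ^ 2)) * Real.sin θ)
        + ∫ θ in ε..(π - ε),
            ((X' θ) ^ 2 / (X θ) ^ 2 + 4 * Real.log (X θ)
              + (Y' θ) ^ 2 / (Real.sin θ ^ 4 * (X θ) ^ 2)) * Real.sin θ)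
      (nhdsWithin 0 (Ioi 0)) (nhds (8 + 4 * Real.log (X 0 * X π))) := by
  have hXc : ContinuousOn X (Icc 0 π) := fun θ hθ => (hX θ hθ).continuousWithinAt
  have hlog : ContinuousOn (fun θ => Real.log (X θ)) (Icc 0 π) :=
    hXc.log fun θ hθ => (hXpos θ hθ).ne'
  set F : ℝ → ℝ := fun θ => -4 * Real.cos θ * (1 + Real.log (X θ)) with hF
  have hFc : ContinuousOn F (Icc 0 π) :=
    (continuousOn_const.mul Real.continuous_cos.continuousOn).mul (continuousOn_const.add hlog)
  have hsmall : ∀ᶠ ε : ℝ in nhdsWithin 0 (Ioi 0), ε ∈ Ioo 0 (π / 2) :=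
    Ioo_mem_nhdsGT (by positivity)
  have hlim : Tendsto (fun ε : ℝ => F (π - ε) - F ε) (nhdsWithin 0 (Ioi 0))
      (nhds (F π - F 0)) := by
    refine Tendsto.sub ?_ ?_
    · refine (hFc π ⟨pi_pos.le, le_rfl⟩).tendsto.comp
        (tendsto_nhdsWithin_iff.2 ⟨?_, ?_⟩)
      · have h : Tendsto (fun ε : ℝ => π - ε) (nhds 0) (nhds (π - 0)) :=
          (continuous_const.sub continuous_id).tendsto 0
        rw [sub_zero] at h
        exact h.mono_left nhdsWithin_le_nhds
      · filter_upwards [hsmall] with ε hε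
        exact ⟨by linarith [hε.1, hε.2], by linarith [hε.1]⟩
    · refine (hFc 0 ⟨le_rfl, pi_pos.le⟩).tendsto.comp
        (tendsto_nhdsWithin_iff.2 ⟨nhdsWithin_le_nhds, ?_⟩)
      filter_upwards [hsmall] with ε hε
      exact ⟨hε.1.le, by linarith [hε.1, hε.2]⟩
  have hval : F π - F 0 = 8 + 4 * Real.log (X 0 * X π) := by
    rw [Real.log_mul (hXpos 0 ⟨le_rfl, pi_pos.le⟩).ne' (hXpos π ⟨pi_pos.le, le_rfl⟩).ne']
    simp only [hF, Real.cos_pi, Real.cos_zero]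
    ring
  rw [← hval]
  refine hlim.congr' ?_
  filter_upwards [hsmall] with ε ⟨hε0, hε1⟩
  have hle : ε ≤ π - ε := by linarith
  have hsub : uIcc ε (π - ε) ⊆ Ioo 0 π := by
    rw [uIcc_of_le hle]
    exact fun θ hθ => ⟨by linarith [hθ.1], by linarith [hθ.2]⟩
  have hsub' : uIcc ε (π - ε) ⊆ Icc 0 π := hsub.trans Ioo_subset_Icc_self
  have hs : ∀ θ ∈ uIcc ε (π - ε), Real.sin θ ≠ 0 := fun θ hθ =>
    (Real.sin_pos_of_mem_Ioo (hsub hθ)).ne'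
  have hx : ∀ θ ∈ uIcc ε (π - ε), X θ ≠ 0 := fun θ hθ => (hXpos θ (hsub' hθ)).ne'
  have cX := hXc.mono hsub'
  have cX' := hX'cont.mono hsub'
  have cY' := hY'cont.mono hsub'
  have cl := hlog.mono hsub'
  have csin : ContinuousOn Real.sin (uIcc ε (π - ε)) := Real.continuous_sin.continuousOn
  have ccos : ContinuousOn Real.cos (uIcc ε (π - ε)) := Real.continuous_cos.continuousOn
  have cq := cX'.div cX hx
  have cT : ContinuousOn (fun θ => (Y' θ) ^ 2 / (Real.sin θ ^ 4 * (X θ) ^ 2))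
      (uIcc ε (π - ε)) :=
    (cY'.pow 2).div ((csin.pow 4).mul (cX.pow 2)) fun θ hθ =>
      mul_ne_zero (pow_ne_zero _ (hs θ hθ)) (pow_ne_zero _ (hx θ hθ))
  rw [← intervalIntegral.integral_add]
  · symm
    have hcongr : ∀ θ ∈ uIcc ε (π - ε),
        (4 - 4 * (Real.cos θ / Real.sin θ) * (X' θ / X θ) - (X' θ / X θ) ^ 2
            - (Y' θ) ^ 2 / (Real.sin θ ^ 4 * (X θ) ^ 2)) * Real.sin θ
          + ((X' θ) ^ 2 / (X θ) ^ 2 + 4 * Real.log (X θ)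
            + (Y' θ) ^ 2 / (Real.sin θ ^ 4 * (X θ) ^ 2)) * Real.sin θ
        = 4 * Real.sin θ * (1 + Real.log (X θ)) + -4 * Real.cos θ * (X' θ / X θ) := by
      intro θ hθ
      have h1 := hs θ hθ
      have h2 := hx θ hθ
      field_simp
      ring
    rw [intervalIntegral.integral_congr hcongr]
    refine intervalIntegral.integral_eq_sub_of_hasDerivAt (fun θ hθ => ?_) ?_
    · have hd : HasDerivAt X (X' θ) θ :=
        (hX θ (hsub' hθ)).hasDerivAt (Icc_mem_nhds (hsub hθ).1 (hsub hθ).2)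
      have h := ((Real.hasDerivAt_cos θ).const_mul (-4)).mul ((hd.log (hx θ hθ)).const_add 1)
      refine h.congr_deriv ?_
      ring
    · exact (((continuousOn_const.mul csin).mul (continuousOn_const.add cl)).add
        ((continuousOn_const.mul ccos).mul cq)).intervalIntegrable
  · exact ((((continuousOn_const.sub ((continuousOn_const.mul (ccos.div csin hs)).mul cq)).sub
      (cq.pow 2)).sub cT).mul csin).intervalIntegrable
  · exact (((((cX'.pow 2).div (cX.pow 2) fun θ hθ => pow_ne_zero _ (hx θ hθ)).add
      (continuousOn_const.mul cl)).add cT).mul csin).intervalIntegrable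
end

section
/- Let m₀ > 0 and δ > 0, and define U₀(r) = 2m₀²/r − 4m₀^{3/2}/√r for r > 0. There exists μ₀ ∈ (0,1/2) such that for every μ ∈ (0,μ₀) and every r with 0 < r ≤ μδ, the function χ̃(r) = 1 − μ·exp(1 − μδ/r) satisfies U₀'(r)·χ̃(r) + U₀(r)·χ̃'(r) > −2m₀²/r² + (3/2)·m₀^{3/2}/r^{3/2}. -/
open Real Filter Set

lemma mul_self_add_one_mul_exp_neg_le_two {s : ℝ} (hs : 0 ≤ s) :
    s * (s + 1) * Real.exp (-s) ≤ 2 := by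
  rw [Real.exp_neg, ← div_eq_mul_inv, div_le_iff₀ (Real.exp_pos s)]
  nlinarith [Real.quadratic_le_exp_of_nonneg hs]

lemma rpow_three_halves {x : ℝ} (hx : 0 < x) : x ^ ((3:ℝ)/2) = x * Real.sqrt x := by
  rw [show (3:ℝ)/2 = 1 + 1/2 by norm_num, Real.rpow_add hx, Real.rpow_one, Real.sqrt_eq_rpow]

lemma hasDerivAt_div_sub_div_sqrt (b c : ℝ) {r : ℝ} (hr : 0 < r) :
    HasDerivAt (fun r => b / r - c / Real.sqrt r)
      (-b / r ^ 2 + c / (2 * (r * Real.sqrt r))) r := by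
  have hq : 0 < Real.sqrt r := Real.sqrt_pos.2 hr
  have hsq : Real.sqrt r ^ 2 = r := Real.sq_sqrt hr.le
  refine (((hasDerivAt_const r b).div (hasDerivAt_id r) hr.ne').sub
    ((hasDerivAt_const r c).div (Real.hasDerivAt_sqrt hr.ne') hq.ne')).congr_deriv ?_
  rw [hsq]
  simp only [id]
  field_simp
  ring

lemma hasDerivAt_exponential_cutoff (μ d : ℝ) {r : ℝ} (hr : 0 < r) :
    HasDerivAt (fun s => 1 - μ * Real.exp (1 - d / s))
      (-(μ * Real.exp (1 - d / r) * d / r ^ 2)) r := by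
  refine (((((hasDerivAt_const r d).div (hasDerivAt_id r) hr.ne').const_sub 1).exp.const_mul
    μ).const_sub 1).congr_deriv ?_
  simp only [id, Pi.div_apply]
  field_simp
  ring

/-- The exponential decay of the cutoff absorbs the leading singular term. -/
lemma cutoff_error_le {m δ μ r : ℝ} (hm : 0 < m) (hμ : 0 < μ) (hr : 0 < r)
    (hrδ : r ≤ μ * δ) (hsmall : 32 * μ * m ≤ δ) :
    4 * μ * Real.exp (1 - μ * δ / r) * m ^ 2 * (μ * δ / r - 1)
      ≤ m ^ ((3:ℝ)/2) * Real.sqrt r := by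
  have hs : 0 ≤ μ * δ / r - 1 := by
    rw [sub_nonneg, le_div_iff₀ hr]; linarith
  obtain ⟨s, hsd⟩ : ∃ s, s = μ * δ / r - 1 := ⟨_, rfl⟩
  have hE : 1 - μ * δ / r = -s := by rw [hsd]; ring
  have hd : μ * δ = r * (s + 1) := by rw [hsd]; field_simp; ring
  rw [hE, ← hsd]
  rw [← hsd] at hs
  have h₁ := mul_self_add_one_mul_exp_neg_le_two hs
  set e := Real.exp (-s) with he
  have hep : 0 < e := Real.exp_pos _
  have h₂ : s * e ≤ 1 := by
    rw [he, Real.exp_neg, ← div_eq_mul_inv, div_le_iff₀ (Real.exp_pos s)]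
    linarith [Real.add_one_le_exp s]
  have h₃ : (s * e) * (s * (s + 1) * e) ≤ 1 * 2 :=
    mul_le_mul h₂ h₁ (by positivity) zero_le_one
  have h₄ : 16 * μ * m * ((s * e) * (s * (s + 1) * e)) ≤ δ := by
    have : 0 < 16 * μ * m := by positivity
    nlinarith
  have h₅ : 16 * μ ^ 2 * m * (s * e) ^ 2 ≤ r := by
    have : μ * (16 * μ * m * ((s * e) * (s * (s + 1) * e))) ≤ μ * δ :=
      mul_le_mul_of_nonneg_left h₄ hμ.le
    rw [hd] at this
    refine le_of_mul_le_mul_right (a := s + 1) ?_ (by linarith)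
    linarith
  rw [rpow_three_halves hm]
  refine abs_le_of_sq_le_sq' ?_ (by positivity) |>.2
  calc (4 * μ * e * m ^ 2 * s) ^ 2 = m ^ 3 * (16 * μ ^ 2 * m * (s * e) ^ 2) := by ring
    _ ≤ m ^ 3 * r := by gcongr
    _ = (m * Real.sqrt m * Real.sqrt r) ^ 2 := by
      rw [mul_pow, mul_pow, Real.sq_sqrt hm.le, Real.sq_sqrt hr.le]; ring

/-- With `U₀(r) = 2m₀²/r − 4m₀^{3/2}/√r`, there is `μ₀ ∈ (0,1/2)` such that for every
`μ ∈ (0,μ₀)` and every `0 < r ≤ μδ`, the exponential cutoff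
`χ̃(r) = 1 − μ exp(1 − μδ/r)` satisfies
`U₀'χ̃ + U₀χ̃' > −2m₀²/r² + (3/2)m₀^{3/2}/r^{3/2}`. -/
theorem exponential_cutoff_derivative_bound (m₀ δ : ℝ) (hm : 0 < m₀) (hδ : 0 < δ)
    (U₀ : ℝ → ℝ)
    (hU : U₀ = fun r => 2 * m₀ ^ 2 / r - 4 * m₀ ^ ((3:ℝ)/2) / Real.sqrt r) :
    ∃ μ₀ ∈ Ioo (0:ℝ) (1/2), ∀ μ ∈ Ioo (0:ℝ) μ₀, ∀ r : ℝ, 0 < r → r ≤ μ * δ →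
      -(2 * m₀ ^ 2) / r ^ 2 + (3/2) * m₀ ^ ((3:ℝ)/2) / r ^ ((3:ℝ)/2)
        < deriv U₀ r * (1 - μ * Real.exp (1 - μ * δ / r))
          + U₀ r * deriv (fun s => 1 - μ * Real.exp (1 - μ * δ / s)) r := by
  refine ⟨min (1/4) (δ / (32 * m₀)), ⟨by positivity, ?_⟩, ?_⟩
  · exact (min_le_left _ _).trans_lt (by norm_num)
  rintro μ ⟨hμ, hμ₀⟩ r hr hrδ
  have hsmall : 32 * μ * m₀ ≤ δ := by
    have := (lt_div_iff₀ (by positivity)).1 (hμ₀.trans_le (min_le_right _ _))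
    linarith
  have herr := cutoff_error_le hm hμ hr hrδ hsmall
  rw [(hasDerivAt_exponential_cutoff μ (μ * δ) hr).deriv, hU,
    (hasDerivAt_div_sub_div_sqrt _ _ hr).deriv, rpow_three_halves hr]
  beta_reduce
  have ha : 0 < m₀ ^ ((3:ℝ)/2) := by positivity
  set a := m₀ ^ ((3:ℝ)/2)
  obtain ⟨t, ht⟩ : ∃ t, t = μ * δ / r := ⟨_, rfl⟩
  have ht1 : 1 ≤ t := by rw [ht, le_div_iff₀ hr]; linarith
  have hd : μ * δ = r * t := by rw [ht]; field_simp
  rw [← ht] at herr ⊢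
  rw [hd]
  have hep : 0 < Real.exp (1 - t) := Real.exp_pos _
  set e := Real.exp (1 - t)
  obtain ⟨q, hqd⟩ : ∃ q, q = Real.sqrt r := ⟨_, rfl⟩
  have hq : 0 < q := hqd ▸ Real.sqrt_pos.2 hr
  have hrq : r = q ^ 2 := by rw [hqd, Real.sq_sqrt hr.le]
  rw [← hqd] at herr ⊢
  subst hrq
  have hpos : 0 < μ * e * (a * q * (4 * t - 2)) := by
    have : 0 < 4 * t - 2 := by linarith
    positivity
  rw [← sub_pos]
  have key : 0 < (a * q / 2 + μ * e * (2 * m₀ ^ 2 * (1 - t) + a * q * (4 * t - 2))) / q ^ 4 := by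
    refine div_pos ?_ (by positivity)
    linarith
  convert key using 1
  field_simp
  ring
end

section
/- For every m₀ > 0 there exist δ > 0 and a smooth non-increasing function χ : [0,∞) → [0,1] with χ(0) = 1, χ^{(k)}(0) = 0 for every k ≥ 1, and χ(r) = 0 for r ≥ 2δ, such that the function U = U₀·χ (where U₀(r) = 2m₀²/r − 4m₀^{3/2}/√r) satisfies, for all r with 0 < r < 5δ: U'(r) > −2m₀²/r² + m₀^{3/2}/r^{3/2} and U'(r) ≤ 0. -/
open Real Filter Set

open scoped Topology

/-- There is a smooth monotone step from `0` to `1`, with transition inside `(0, 1/4)`, whose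
logarithmic derivative `x ψ'(x) / ψ(x)` exceeds `1` only up to an error controlled by `√x`. -/
theorem exists_smooth_step_mul_deriv_le :
    ∃ ψ : ℝ → ℝ, ContDiff ℝ (⊤ : ℕ∞) ψ ∧ Monotone ψ ∧ (∀ x ≤ 1 / 10000, ψ x = 0) ∧
      (∀ x, 1 / 4 ≤ x → ψ x = 1) ∧ ∀ x, 0 < x → x * deriv ψ x ≤ ψ x + √x / 2 := by
  set g : ℝ → ℝ := fun x ↦ smoothTransition (10000 * x - 1) * (1 - smoothTransition (8 * x - 1))
    with hg
  have hgs : ContDiff ℝ (⊤ : ℕ∞) g :=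
    (smoothTransition.contDiff.comp (by fun_prop)).mul
      (contDiff_const.sub (smoothTransition.contDiff.comp (by fun_prop)))
  have hgc : Continuous g := hgs.continuous
  have hg0 : ∀ x, 0 ≤ g x := fun x ↦
    mul_nonneg (smoothTransition.nonneg _) (sub_nonneg.2 (smoothTransition.le_one _))
  have hg1 : ∀ x, g x ≤ 1 := fun x ↦
    mul_le_one₀ (smoothTransition.le_one _) (sub_nonneg.2 (smoothTransition.le_one _))
      (sub_le_self _ (smoothTransition.nonneg _))
  have hgl : ∀ x ≤ 1 / 10000, g x = 0 := fun x hx ↦ by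
    simp only [hg]
    rw [smoothTransition.zero_of_nonpos (by linarith), zero_mul]
  have hgr : ∀ x, 1 / 4 ≤ x → g x = 0 := fun x hx ↦ by
    simp only [hg]
    rw [smoothTransition.one_of_one_le (x := 8 * x - 1) (by linarith), sub_self, mul_zero]
  have hganti : ∀ t x, 1 / 5000 ≤ t → t ≤ x → g x ≤ g t := fun t x ht htx ↦ by
    simp only [hg]
    rw [smoothTransition.one_of_one_le (x := 10000 * t - 1) (by linarith),
      smoothTransition.one_of_one_le (x := 10000 * x - 1) (by linarith), one_mul, one_mul]
    exact sub_le_sub_left (smoothTransition.monotone (by linarith)) _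
  set G : ℝ → ℝ := fun x ↦ ∫ t in (0 : ℝ)..x, g t with hG
  have hGd : ∀ x, HasDerivAt G (g x) x := fun x ↦
    (hgc.integral_hasStrictDerivAt 0 x).hasDerivAt
  have hGdiff : Differentiable ℝ G := fun x ↦ (hGd x).differentiableAt
  have hGderiv : deriv G = g := funext fun x ↦ (hGd x).deriv
  have hGs : ContDiff ℝ (⊤ : ℕ∞) G :=
    contDiff_infty_iff_deriv.2 ⟨hGdiff, by rwa [hGderiv]⟩
  have hGm : Monotone G :=
    monotone_of_deriv_nonneg hGdiff fun x ↦ by rw [hGderiv]; exact hg0 x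
  have hGl : ∀ x ≤ 1 / 10000, G x = 0 := fun x hx ↦ by
    have : EqOn g (fun _ ↦ 0) (uIcc 0 x) := fun t ht ↦
      hgl t (ht.2.trans (max_le (by norm_num) hx))
    simp only [hG]
    rw [intervalIntegral.integral_congr this, intervalIntegral.integral_zero]
  have hGadd : ∀ a x, G x = G a + ∫ t in a..x, g t := fun a x ↦
    (intervalIntegral.integral_add_adjacent_intervals
      (hgc.intervalIntegrable _ _) (hgc.intervalIntegrable _ _)).symm
  have hGr : ∀ x, 1 / 4 ≤ x → G x = G (1 / 4) := fun x hx ↦ by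
    have : EqOn g (fun _ ↦ 0) (uIcc (1 / 4) x) := fun t ht ↦
      hgr t (by rw [uIcc_of_le hx] at ht; exact ht.1)
    rw [hGadd (1 / 4), intervalIntegral.integral_congr this, intervalIntegral.integral_zero,
      add_zero]
  have hG0 : G 0 = 0 := hGl 0 (by norm_num)
  have hmul : ∀ x, 1 / 5000 ≤ x → (x - 1 / 5000) * g x ≤ G x := fun x hx ↦ by
    have h := intervalIntegral.integral_mono_on (μ := MeasureTheory.volume) hx
      (intervalIntegrable_const (c := g x)) (hgc.intervalIntegrable _ _)
      fun t ht ↦ hganti t x ht.1 ht.2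
    rw [intervalIntegral.integral_const, smul_eq_mul] at h
    rw [hGadd (1 / 5000) x]
    have : G 0 ≤ G (1 / 5000) := hGm (by norm_num)
    linarith
  have hJ : 12 / 100 ≤ G (1 / 4) := by
    have h := hmul (1 / 8) (by norm_num)
    have h1 : g (1 / 8) = 1 := by
      simp only [hg]
      rw [smoothTransition.one_of_one_le (by norm_num),
        smoothTransition.zero_of_nonpos (by norm_num)]
      norm_num
    have : G (1 / 8) ≤ G (1 / 4) := hGm (by norm_num)
    rw [h1] at h
    linarith
  have hJ0 : 0 < G (1 / 4) := by linarith
  refine ⟨fun x ↦ G x / G (1 / 4), hGs.div_const _, fun x y hxy ↦ ?_, fun x hx ↦ ?_,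
    fun x hx ↦ ?_, fun x hx ↦ ?_⟩
  · exact div_le_div_of_nonneg_right (hGm hxy) hJ0.le
  · simp [hGl x hx]
  · simp only [hGr x hx]
    exact div_self hJ0.ne'
  · rw [((hGd x).div_const _).deriv, ← mul_div_assoc, div_add' _ _ _ hJ0.ne']
    refine div_le_div_of_nonneg_right ?_ hJ0.le
    have hGx : 0 ≤ G x := hG0 ▸ hGm hx.le
    rcases le_total x (1 / 10000) with h | h
    · rw [hgl x h, mul_zero]
      positivity
    · have hs : 1 / 100 ≤ √x := Real.le_sqrt_of_sq_le (by linarith)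
      have h1 : x * g x ≤ G x + 1 / 5000 := by
        rcases le_total x (1 / 5000) with h' | h'
        · nlinarith [hg1 x, hg0 x]
        · nlinarith [hmul x h', hg1 x]
      nlinarith

/-- The pointwise estimate behind the cutoff, in terms of `s = √x`: `p = ψ(x)`, `d = ψ'(x)`. -/
theorem lt_model_deriv_of_mul_deriv_le {s p d : ℝ} (hs : 0 < s) (hs2 : s ≤ 1 / 2) (hp : 0 ≤ p)
    (h : s ^ 2 * d ≤ p + s / 2) :
    -2 / s ^ 4 + 1 / s ^ 3 < (-2 / s ^ 4 + 2 / s ^ 3) * (1 - p) + (2 / s ^ 2 - 4 / s) * -d := by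
  have key : (1 - 2 * s) * (s ^ 2 * d) ≤ (1 - 2 * s) * (p + s / 2) :=
    mul_le_mul_of_nonneg_left h (by linarith)
  have e : (-2 / s ^ 4 + 2 / s ^ 3) * (1 - p) + (2 / s ^ 2 - 4 / s) * -d
      - (-2 / s ^ 4 + 1 / s ^ 3)
      = (2 * p * (1 - s) + s - 2 * ((1 - 2 * s) * (s ^ 2 * d))) / s ^ 4 := by
    field_simp
    ring
  rw [← sub_pos, e]
  apply div_pos _ (by positivity)
  nlinarith [mul_nonneg hp hs.le, mul_pos hs hs]

/-- Derivative of the rescaled, cut off model height function `U₀`, with `m₀ = n²`, `r = (n s)²`. -/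
theorem hasDerivAt_model_mul {n s p d : ℝ} {χ : ℝ → ℝ} (hn : 0 < n) (hs : 0 < s)
    (hp : χ ((n * s) ^ 2) = p) (hχ : HasDerivAt χ (d / n ^ 2) ((n * s) ^ 2)) :
    HasDerivAt (fun t ↦ (2 * (n ^ 2) ^ 2 / t - 4 * n ^ 3 / √t) * χ t)
      ((-2 / s ^ 4 + 2 / s ^ 3) * p + (2 / s ^ 2 - 4 / s) * d) ((n * s) ^ 2) := by
  have hr : (n * s) ^ 2 ≠ 0 := by positivity
  have hsq : √((n * s) ^ 2) = n * s := Real.sqrt_sq (by positivity)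
  have h1 := (hasDerivAt_const ((n * s) ^ 2) (2 * (n ^ 2) ^ 2)).fun_div
    (hasDerivAt_id' ((n * s) ^ 2)) hr
  have h2 := (hasDerivAt_const ((n * s) ^ 2) (4 * n ^ 3)).fun_div (Real.hasDerivAt_sqrt hr)
    (by rw [hsq]; positivity)
  refine ((h1.fun_sub h2).fun_mul hχ).congr_deriv ?_
  simp only [hsq, hp]
  field_simp
  ring

/-- For every `m₀ > 0` there exist `δ > 0` and a smooth non-increasing cutoff
`χ : [0,∞) → [0,1]` with `χ(0) = 1`, `χ^{(k)}(0) = 0` for `k ≥ 1` and `χ = 0` on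
`[2δ,∞)` such that `U = U₀·χ`, where `U₀(r) = 2m₀²/r − 4m₀^{3/2}/√r`, satisfies
`−2m₀²/r² + m₀^{3/2}/r^{3/2} < U'(r) ≤ 0` for all `0 < r < 5δ`. -/
theorem exists_smooth_cutoff (m₀ : ℝ) (hm : 0 < m₀) :
    ∃ δ : ℝ, 0 < δ ∧ ∃ χ : ℝ → ℝ,
      ContDiffOn ℝ (⊤ : ℕ∞) χ (Ici 0) ∧
      AntitoneOn χ (Ici 0) ∧
      (∀ r ∈ Ici (0:ℝ), χ r ∈ Icc (0:ℝ) 1) ∧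
      χ 0 = 1 ∧
      (∀ k : ℕ, 1 ≤ k → iteratedDerivWithin k χ (Ici 0) 0 = 0) ∧
      (∀ r : ℝ, 2 * δ ≤ r → χ r = 0) ∧
      (∀ r : ℝ, 0 < r → r < 5 * δ →
        -(2 * m₀ ^ 2) / r ^ 2 + m₀ ^ ((3:ℝ)/2) / r ^ ((3:ℝ)/2)
            < deriv (fun s => (2 * m₀ ^ 2 / s - 4 * m₀ ^ ((3:ℝ)/2) / Real.sqrt s) * χ s) r ∧
        deriv (fun s => (2 * m₀ ^ 2 / s - 4 * m₀ ^ ((3:ℝ)/2) / Real.sqrt s) * χ s) r ≤ 0) := by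
  obtain ⟨ψ, hψs, hψm, hψl, hψr, hψd⟩ := exists_smooth_step_mul_deriv_le
  have hψ0 : ∀ x, 0 ≤ ψ x := fun x ↦
    hψl (min x (1 / 10000)) (min_le_right _ _) ▸ hψm (min_le_left _ _)
  have hψ1 : ∀ x, ψ x ≤ 1 := fun x ↦
    hψr (max x (1 / 4)) (le_max_right _ _) ▸ hψm (le_max_left _ _)
  have hloc : (fun r ↦ 1 - ψ (r / m₀)) =ᶠ[𝓝[Ici 0] 0] fun _ ↦ (1 : ℝ) := by
    apply Filter.Eventually.filter_mono nhdsWithin_le_nhds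
    filter_upwards [Iio_mem_nhds (show (0 : ℝ) < 1 / 10000 * m₀ by positivity)] with r hr
    rw [hψl _ ((div_le_iff₀ hm).2 (le_of_lt hr)), sub_zero]
  have h0 : 1 - ψ (0 / m₀) = 1 := by rw [hψl _ (by norm_num), sub_zero]
  refine ⟨m₀ / 8, by positivity, fun r ↦ 1 - ψ (r / m₀), ?_, ?_, ?_, h0, ?_, ?_, ?_⟩
  · exact (contDiff_const.sub (hψs.comp (contDiff_id.div_const _))).contDiffOn
  · intro a _ b _ hab
    exact sub_le_sub_left (hψm (div_le_div_of_nonneg_right hab hm.le)) _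
  · exact fun r _ ↦ ⟨sub_nonneg.2 (hψ1 _), sub_le_self _ (hψ0 _)⟩
  · intro k hk
    rw [hloc.iteratedDerivWithin_eq h0, iteratedDerivWithin_const, if_neg (by lia)]
  · intro r hr
    have h : 1 / 4 ≤ r / m₀ := (le_div_iff₀ hm).2 (by linarith)
    simp only [hψr _ h, sub_self]
  · intro r hr hr5
    obtain ⟨n, hn, rfl⟩ : ∃ n : ℝ, 0 < n ∧ m₀ = n ^ 2 :=
      ⟨√m₀, Real.sqrt_pos.2 hm, (Real.sq_sqrt hm.le).symm⟩
    obtain ⟨s, hs, rfl⟩ : ∃ s : ℝ, 0 < s ∧ r = (n * s) ^ 2 :=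
      ⟨√r / n, by positivity, by rw [mul_div_cancel₀ _ hn.ne', Real.sq_sqrt hr.le]⟩
    have hpow : ∀ a : ℝ, 0 < a → (a ^ 2) ^ ((3 : ℝ) / 2) = a ^ 3 := fun a ha ↦ by
      rw [← Real.rpow_natCast_mul ha.le, ← Real.rpow_natCast]
      norm_num
    have hx : (n * s) ^ 2 / n ^ 2 = s ^ 2 := by field_simp
    have hs1 : s ≤ 1 := by
      have : s ^ 2 < 1 := by
        rw [← hx, div_lt_one hm]
        linarith
      nlinarith
    have hψdiff : HasDerivAt ψ (deriv ψ (s ^ 2)) ((n * s) ^ 2 / n ^ 2) := by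
      rw [hx]
      exact (hψs.differentiable (by simp) _).hasDerivAt
    have hχ : HasDerivAt (fun r ↦ 1 - ψ (r / n ^ 2)) (-deriv ψ (s ^ 2) / n ^ 2)
        ((n * s) ^ 2) := by
      refine ((hψdiff.comp ((n * s) ^ 2)
        ((hasDerivAt_id _).div_const (n ^ 2))).const_sub 1).congr_deriv ?_
      ring
    have hd0 : 0 ≤ deriv ψ (s ^ 2) := hψm.deriv_nonneg
    have hD := hψd (s ^ 2) (by positivity)
    rw [Real.sqrt_sq hs.le] at hD
    have hlarge : 1 / 2 < s → ψ (s ^ 2) = 1 ∧ deriv ψ (s ^ 2) = 0 := fun h ↦ by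
      refine ⟨hψr _ (by nlinarith), ?_⟩
      have : ψ =ᶠ[𝓝 (s ^ 2)] fun _ ↦ 1 := by
        filter_upwards [Ioi_mem_nhds (show 1 / 4 < s ^ 2 by nlinarith)] with y hy
        exact hψr y (le_of_lt hy)
      rw [this.deriv_eq, deriv_const]
    have hlow : -(2 * (n ^ 2) ^ 2) / ((n * s) ^ 2) ^ 2 + n ^ 3 / (n * s) ^ 3
        = -2 / s ^ 4 + 1 / s ^ 3 := by
      field_simp
    rw [hpow n hn, hpow (n * s) (by positivity),
      (hasDerivAt_model_mul hn hs (congrArg (fun x ↦ 1 - ψ x) hx) hχ).deriv, hlow]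
    have hcoef : -2 / s ^ 4 + 2 / s ^ 3 ≤ 0 := by
      rw [show -2 / s ^ 4 + 2 / s ^ 3 = -(2 * (1 - s) / s ^ 4) by field_simp; ring]
      exact neg_nonpos.2 (div_nonneg (by linarith) (by positivity))
    rcases le_or_gt s (1 / 2) with h | h
    · refine ⟨lt_model_deriv_of_mul_deriv_le hs h (hψ0 _) hD, ?_⟩
      have hU : 0 ≤ 2 / s ^ 2 - 4 / s := by
        rw [show 2 / s ^ 2 - 4 / s = 2 * (1 - 2 * s) / s ^ 2 by field_simp; ring]
        exact div_nonneg (by linarith) (by positivity)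
      exact add_nonpos (mul_nonpos_of_nonpos_of_nonneg hcoef (sub_nonneg.2 (hψ1 _)))
        (mul_nonpos_of_nonneg_of_nonpos hU (neg_nonpos.2 hd0))
    · rw [(hlarge h).1, (hlarge h).2, sub_self, neg_zero, mul_zero, mul_zero, add_zero]
      refine ⟨?_, le_rfl⟩
      rw [show -2 / s ^ 4 + 1 / s ^ 3 = -((2 - s) / s ^ 4) by field_simp; ring]
      exact neg_neg_of_pos (div_pos (by linarith) (by positivity))
end
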